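/- Let n ≥ 2, 1 ≤ k ≤ n−1 and 1 ≤ m ≤ k be integers and p > 0 a real number. Define, for 0 < s ≤ t, f_{n,k}^t(s) = p·(n−k)·C(n−1,n−k)·((ps)^{n−k−1}/(1+ps)^n)·((1+pt)^{n−k}/(pt)^{n−1})·(pt−ps)^{k−1}, and f_{n,k}^t(s) = 0 for s > t; define h_n^(0)(t) = p·n·(pt)^{n−1}/(1+pt)^{n+1} for t > 0. Then ∫_0^∞ s^m ( ∫_0^∞ f_{n,k}^t(s) · h_n^(0)(t) dt ) ds = C(n−k+m−1, m) / (p^m · C(k, m)). -/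

import Mathlib

open MeasureTheory

lemma aux_tend0 (a b : ℕ) : Filter.Tendsto (fun x : ℝ => x ^ a / (1 + x) ^ (a + b + 1))
    Filter.atTop (nhds 0) := by
  have h1 : Filter.Tendsto (fun x : ℝ => (1 + x)⁻¹) Filter.atTop (nhds 0) :=
    tendsto_inv_atTop_zero.comp (Filter.tendsto_atTop_add_const_left _ 1 Filter.tendsto_id)
  refine squeeze_zero' ?_ ?_ h1
  · filter_upwards [Filter.eventually_gt_atTop 0] with x hx
    positivity
  · filter_upwards [Filter.eventually_gt_atTop 0] with x hx
    rw [div_le_iff₀ (by positivity)]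
    have : (1 + x)⁻¹ * (1 + x) ^ (a + b + 1) = (1 + x) ^ a * (1 + x) ^ b := by
      field_simp
      ring
    rw [this]
    calc x ^ a ≤ (1 + x) ^ a := by gcongr; linarith
      _ ≤ (1 + x) ^ a * (1 + x) ^ b :=
        le_mul_of_one_le_right (by positivity) (one_le_pow₀ (by linarith))

lemma aux_beta (b a : ℕ) :
    IntegrableOn (fun x : ℝ => x ^ a / (1 + x) ^ (a + b + 2)) (Set.Ioi 0) ∧
    ∫ x in Set.Ioi (0 : ℝ), x ^ a / (1 + x) ^ (a + b + 2) =
      (a.factorial : ℝ) * b.factorial / (a + b + 1).factorial := by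
  induction a with
  | zero =>
    have hd : ∀ x ∈ Set.Ici (0 : ℝ), HasDerivAt
        (fun x : ℝ => -(1 / ((b : ℝ) + 1)) * (x ^ 0 / (1 + x) ^ (0 + b + 1)))
        (x ^ 0 / (1 + x) ^ (0 + b + 2)) x := by
      intro x hx
      have hx : 0 ≤ x := hx
      have h1 : HasDerivAt (fun x : ℝ => (1 + x) ^ (0 + b + 1))
          (((0 + b + 1 : ℕ) : ℝ) * (1 + x) ^ (0 + b) * 1) x := by
        exact ((hasDerivAt_id x).const_add 1).fun_pow (0 + b + 1)
      have h2 := ((hasDerivAt_pow 0 x).fun_div h1 (by positivity)).const_mul (-(1 / ((b : ℝ) + 1)))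
      refine h2.congr_deriv ?_
      have : (1 + x) ≠ 0 := by positivity
      have : (b : ℝ) + 1 ≠ 0 := by positivity
      push_cast
      simp only [pow_add]
      field_simp
      ring
    have hnn : ∀ x ∈ Set.Ioi (0 : ℝ), 0 ≤ x ^ 0 / (1 + x) ^ (0 + b + 2) := by
      intro x hx
      have hx : 0 < x := hx
      positivity
    have ht := (aux_tend0 0 b).const_mul (-(1 / ((b : ℝ) + 1)))
    refine ⟨integrableOn_Ioi_deriv_of_nonneg' hd hnn ht, ?_⟩
    rw [integral_Ioi_of_hasDerivAt_of_nonneg' hd hnn ht]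
    simp only [zero_add, Nat.factorial_succ, Nat.factorial_zero]
    have : (b.factorial : ℝ) ≠ 0 := by positivity
    push_cast
    field_simp
    simp
  | succ a ih =>
    obtain ⟨hi, hv⟩ := ih
    have hint : IntegrableOn (fun x : ℝ => x ^ (a+1) / (1 + x) ^ (a + 1 + b + 2)) (Set.Ioi 0) := by
      refine Integrable.mono' hi (Measurable.aestronglyMeasurable (by fun_prop)) ?_
      filter_upwards [ae_restrict_mem measurableSet_Ioi] with x hx
      have hx : 0 < x := hx
      rw [Real.norm_of_nonneg (by positivity)]
      rw [div_le_div_iff₀ (by positivity) (by positivity)]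
      have : x ^ a * (1 + x) ^ (a + 1 + b + 2) - x ^ (a+1) * (1 + x) ^ (a + b + 2)
        = x ^ a * (1 + x) ^ (a + b + 2) := by ring
      have : 0 ≤ x ^ a * (1 + x) ^ (a + b + 2) := by positivity
      linarith
    refine ⟨hint, ?_⟩
    have hd : ∀ x ∈ Set.Ici (0 : ℝ), HasDerivAt
        (fun x : ℝ => x ^ (a+1) / (1 + x) ^ (a + 1 + b + 1))
        (((a:ℝ) + 1) * (x ^ a / (1 + x) ^ (a + b + 2))
          - ((a:ℝ) + b + 2) * (x ^ (a+1) / (1 + x) ^ (a + 1 + b + 2))) x := by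
      intro x hx
      have hx : 0 ≤ x := hx
      have h1 : HasDerivAt (fun x : ℝ => (1 + x) ^ (a + 1 + b + 1))
          (((a + 1 + b + 1 : ℕ) : ℝ) * (1 + x) ^ (a + 1 + b) * 1) x := by
        exact ((hasDerivAt_id x).const_add 1).fun_pow (a + 1 + b + 1)
      have h2 := (hasDerivAt_pow (a+1) x).fun_div h1 (by positivity)
      refine h2.congr_deriv ?_
      have : (1 + x) ≠ 0 := by positivity
      push_cast
      simp only [pow_add, Nat.add_sub_cancel]
      field_simp
      ring
    have h := integral_Ioi_of_hasDerivAt_of_tendsto' hd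
      ((hi.const_mul _).sub (hint.const_mul _)) (aux_tend0 (a+1) b)
    rw [integral_sub (hi.const_mul _) (hint.const_mul _), integral_const_mul, integral_const_mul,
      hv] at h
    have h0 : ((a:ℝ) + b + 2) ≠ 0 := by positivity
    have e : (a + 1 + b + 1).factorial = (a + b + 2) * (a + b + 1).factorial := by
      rw [show a + 1 + b + 1 = (a + b + 1) + 1 by ring, Nat.factorial_succ]
    rw [e, Nat.factorial_succ]
    have h3 : ((a + b + 1).factorial : ℝ) ≠ 0 := by positivity
    push_cast
    simp only [ne_eq, Nat.succ_ne_zero, not_false_eq_true, zero_pow, zero_div, sub_zero] at h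
    rw [eq_div_iff (by positivity)]
    field_simp at h
    linarith

lemma aux_inner (k : ℕ) (p s : ℝ) (hp : 0 < p) (hs : 0 < s) :
    ∫ t in Set.Ioi s, p * (p * t - p * s) ^ k / (1 + p * t) ^ (k + 2)
      = 1 / (((k : ℝ) + 1) * (1 + p * s)) := by
  have hps : 0 < p * s := by positivity
  have hd : ∀ t ∈ Set.Ici s, HasDerivAt
      (fun t : ℝ => 1 / (((k : ℝ) + 1) * (1 + p * s)) * (1 - (1 + p * s) / (1 + p * t)) ^ (k+1))
      (p * (p * t - p * s) ^ k / (1 + p * t) ^ (k + 2)) t := by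
    intro t ht
    have ht : s ≤ t := ht
    have ht0 : 0 < t := by linarith
    have h0 : 1 + p * t ≠ 0 := by positivity
    have h1 : HasDerivAt (fun t : ℝ => 1 + p * t) (p * 1) t :=
      ((hasDerivAt_id t).const_mul p).const_add 1
    have h2 := ((((hasDerivAt_const t (1 + p * s)).fun_div h1 h0).const_sub 1).fun_pow (k+1)).const_mul
      (1 / (((k : ℝ) + 1) * (1 + p * s)))
    refine h2.congr_deriv ?_
    have e : p * t - p * s = (1 - (1 + p * s) / (1 + p * t)) * (1 + p * t) := by
      field_simp; ring
    rw [e, mul_pow]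
    simp only [Nat.add_sub_cancel]
    generalize 1 - (1 + p * s) / (1 + p * t) = u
    push_cast
    field_simp
    ring
  have hnn : ∀ t ∈ Set.Ioi s, 0 ≤ p * (p * t - p * s) ^ k / (1 + p * t) ^ (k + 2) := by
    intro t ht
    have ht : s < t := ht
    have : 0 ≤ p * t - p * s := by nlinarith
    have : 0 < t := by linarith
    positivity
  have h1 : Filter.Tendsto (fun t : ℝ => (1 + p * s) / (1 + p * t)) Filter.atTop (nhds 0) :=
    Filter.Tendsto.const_div_atTop (Filter.tendsto_atTop_add_const_left _ 1
      (Filter.tendsto_id.const_mul_atTop hp)) _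
  have ht := ((h1.const_sub 1).pow (k+1)).const_mul (1 / (((k : ℝ) + 1) * (1 + p * s)))
  rw [integral_Ioi_of_hasDerivAt_of_nonneg' hd hnn ht]
  have : 1 + p * s ≠ 0 := by positivity
  simp [div_self this]

/-- Proposition 2.6 (explicit moment formula, uniform prior): the `m`-th moment of the time
to the `k`-th most recent common ancestor under the uniform prior on the time of origin. -/
theorem stmt_4 (n k m : ℕ) (hn : 2 ≤ n) (hk1 : 1 ≤ k) (hk2 : k ≤ n - 1) (hm1 : 1 ≤ m)
    (hm2 : m ≤ k) (p : ℝ) (hp : 0 < p) :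
    ∫ s in Set.Ioi (0 : ℝ), s ^ m *
        ∫ t in Set.Ioi (0 : ℝ),
          (if s ≤ t then
              p * ((n - k : ℕ) : ℝ) * (Nat.choose (n - 1) (n - k) : ℝ) *
                ((p * s) ^ (n - k - 1) / (1 + p * s) ^ n) *
                ((1 + p * t) ^ (n - k) / (p * t) ^ (n - 1)) * (p * t - p * s) ^ (k - 1)
            else 0) *
            (p * n * (p * t) ^ (n - 1) / (1 + p * t) ^ (n + 1))
      = (Nat.choose (n - k + m - 1) m : ℝ) / (p ^ m * (Nat.choose k m : ℝ)) := by
  obtain ⟨c, rfl⟩ : ∃ c, k = m + c := ⟨k - m, by omega⟩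
  obtain ⟨q, rfl⟩ : ∃ q, m = q + 1 := ⟨m - 1, by omega⟩
  obtain ⟨d, rfl⟩ : ∃ d, n = (q + 1 + c) + d + 1 := ⟨n - (q + 1 + c) - 1, by omega⟩
  clear hn hk1 hk2 hm1 hm2
  have e1 : q + 1 + c + d + 1 - (q + 1 + c) = d + 1 := by omega
  have e2 : q + 1 + c + d + 1 - 1 = q + c + d + 1 := by omega
  have e3 : q + 1 + c - 1 = q + c := by omega
  have e4 : d + 1 + (q + 1) - 1 = d + (q + 1) := by omega
  simp only [e1, e2, e3, e4, Nat.add_sub_cancel]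
  set N : ℝ := ((q + 1 + c + d + 1 : ℕ) : ℝ) with hN
  set C : ℝ := ((q + c + d + 1).choose (d + 1) : ℝ) with hC
  set K : ℝ := p / p ^ (q+1) * N * ((d + 1 : ℕ) : ℝ) * C / ((q + c : ℕ) + 1 : ℝ) with hK
  have key : ∀ s ∈ Set.Ioi (0:ℝ), (s ^ (q+1) * ∫ t in Set.Ioi (0 : ℝ),
          (if s ≤ t then
              p * ((d + 1 : ℕ) : ℝ) * C *
                ((p * s) ^ d / (1 + p * s) ^ (q + 1 + c + d + 1)) *
                ((1 + p * t) ^ (d + 1) / (p * t) ^ (q + c + d + 1)) * (p * t - p * s) ^ (q + c)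
            else 0) *
            (p * N * (p * t) ^ (q + c + d + 1) / (1 + p * t) ^ (q + 1 + c + d + 1 + 1)))
      = K * ((fun x : ℝ => x ^ (d + (q+1)) / (1 + x) ^ (d + (q + 1) + c + 2)) (p * s)) := by
    intro s hs
    have hs : 0 < s := hs
    have hi : (∫ t in Set.Ioi (0 : ℝ),
          (if s ≤ t then
              p * ((d + 1 : ℕ) : ℝ) * C *
                ((p * s) ^ d / (1 + p * s) ^ (q + 1 + c + d + 1)) *
                ((1 + p * t) ^ (d + 1) / (p * t) ^ (q + c + d + 1)) * (p * t - p * s) ^ (q + c)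
            else 0) *
            (p * N * (p * t) ^ (q + c + d + 1) / (1 + p * t) ^ (q + 1 + c + d + 1 + 1)))
        = ∫ t in Set.Ioi (0 : ℝ), (Set.Ici s).indicator (fun t =>
            (p * ((d + 1 : ℕ) : ℝ) * C * ((p * s) ^ d / (1 + p * s) ^ (q + 1 + c + d + 1)) * N) *
            (p * (p * t - p * s) ^ (q + c) / (1 + p * t) ^ (q + c + 2))) t := by
      refine setIntegral_congr_fun measurableSet_Ioi ?_
      intro t ht
      have ht : 0 < t := ht
      by_cases hst : s ≤ t
      · have hb : 1 + p * t ≠ 0 := by positivity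
        have hb' : 1 + p * s ≠ 0 := by positivity
        simp only [hst, if_true, Set.indicator, Set.mem_Ici]
        rw [show q + 1 + c + d + 1 + 1 = (q + c + 2) + (d + 1) by ring,
          pow_add (1 + p * t) (q + c + 2)]
        have hpt : (p * t) ^ (q + c + d + 1) ≠ 0 := by positivity
        generalize (p * t) ^ (q + c + d + 1) = A at *
        generalize (p * t - p * s) ^ (q + c) = B at *
        have h2 : (1 + p * t) ^ (d + 1) ≠ 0 := by positivity
        have h3 : (1 + p * t) ^ (q + c + 2) ≠ 0 := by positivity
        have h4 : (1 + p * s) ^ (q + 1 + c + d + 1) ≠ 0 := by positivity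
        generalize (1 + p * t) ^ (d + 1) = D at *
        generalize (1 + p * t) ^ (q + c + 2) = E at *
        generalize (1 + p * s) ^ (q + 1 + c + d + 1) = F at *
        field_simp
      · simp [hst]
    rw [hi, setIntegral_indicator measurableSet_Ici,
      Set.inter_eq_self_of_subset_right (Set.Ici_subset_Ioi.2 hs),
      integral_Ici_eq_integral_Ioi, integral_const_mul, aux_inner _ p s hp hs, hK]
    have hb' : 1 + p * s ≠ 0 := by positivity
    have : ((q + c : ℕ) + 1 : ℝ) ≠ 0 := by positivity
    rw [show d + (q + 1) + c + 2 = (q + 1 + c + d + 1) + 1 by ring]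
    have h4 : (1 + p * s) ^ (q + 1 + c + d + 1) ≠ 0 := by positivity
    simp only [pow_succ (1 + p * s) (q + 1 + c + d + 1)]
    generalize (1 + p * s) ^ (q + 1 + c + d + 1) = F at *
    rw [pow_add (p * s) d, mul_pow p s (q+1)]
    have : p ^ (q+1) ≠ 0 := by positivity
    generalize p ^ (q+1) = P at *
    generalize ((q + c : ℕ) + 1 : ℝ) = G at *
    field_simp
  rw [setIntegral_congr_fun measurableSet_Ioi key, integral_const_mul,
    integral_comp_mul_left_Ioi (fun x : ℝ => x ^ (d + (q+1)) / (1 + x) ^ (d + (q + 1) + c + 2)) 0 hp, mul_zero, (aux_beta c (d + (q+1))).2]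
  rw [hK, hN, hC, Nat.cast_choose ℝ (show d + 1 ≤ q + c + d + 1 by omega),
    Nat.cast_choose ℝ (show q + 1 ≤ d + (q + 1) by omega),
    Nat.cast_choose ℝ (show q + 1 ≤ q + 1 + c by omega)]
  rw [show q + c + d + 1 - (d + 1) = q + c by omega, show d + (q + 1) - (q + 1) = d by omega,
    show q + 1 + c - (q + 1) = c by omega, show d + (q + 1) + c + 1 = (q + c + d + 1) + 1 by ring,
    show q + 1 + c = (q + c) + 1 by ring, Nat.factorial_succ (q + c + d + 1),
    Nat.factorial_succ (q + c), Nat.factorial_succ d]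
  have hz : ((q:ℝ) + c + d + 1 + 1) ≠ 0 := by positivity
  have hz2 : ((q:ℝ) + c + 1) ≠ 0 := by positivity
  have hz3 : ((d:ℝ) + 1) ≠ 0 := by positivity
  have f1 : ((q + c + d + 1).factorial : ℝ) ≠ 0 := by positivity
  have f2 : ((q + c).factorial : ℝ) ≠ 0 := by positivity
  have f3 : ((d).factorial : ℝ) ≠ 0 := by positivity
  have f4 : ((c).factorial : ℝ) ≠ 0 := by positivity
  have f5 : ((q + 1).factorial : ℝ) ≠ 0 := by positivity
  have f6 : p ^ (q+1) ≠ 0 := by positivity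
  push_cast
  simp only [smul_eq_mul]
  generalize p ^ (q+1) = P at *
  field_simp
  ring
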